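/- (Cayley–Bacharach) Let F and G be nonzero homogeneous polynomials in ℂ[x,y,z] of degrees p and q respectively, with no common nonconstant factor, whose common zero set in ℙ²(ℂ) consists of exactly p·q distinct points. Let H be a nonzero homogeneous polynomial of degree r ≤ p + q − 3 which vanishes at p·q − 1 of these points. Then H also vanishes at the remaining point of intersection. -/

import Mathlib

open MvPolynomial

noncomputable section

/-- Polynomials in three variables over `ℂ`. -/
abbrev Poly3 : Type := MvPolynomial (Fin 3) ℂ

/-- The complex projective plane `ℙ²(ℂ)`, the projectivization of `ℂ³`. -/
abbrev ProjPlane : Type := Projectivization ℂ (Fin 3 → ℂ)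

/-- A (homogeneous) polynomial vanishes at a projective point if it vanishes at its
canonical nonzero representative vector (for homogeneous polynomials this is equivalent
to vanishing at any nonzero representative vector). -/
def VanishesAt (F : Poly3) (p : ProjPlane) : Prop :=
  MvPolynomial.eval p.rep F = 0

/-- The set of points of `ℙ²(ℂ)` at which `F` vanishes. -/
def zeroSet (F : Poly3) : Set ProjPlane := {p | VanishesAt F p}

/-- Two defining polynomials give the same curve iff they are proportional by a
nonzero scalar. -/
def ProportionalTo (F G : Poly3) : Prop := ∃ c : ℂ, c ≠ 0 ∧ G = c • F

/-- A set of points is collinear if some nonzero homogeneous polynomial of degree 1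
vanishes at all of them. -/
def Collin (s : Set ProjPlane) : Prop :=
  ∃ L : Poly3, L ≠ 0 ∧ L.IsHomogeneous 1 ∧ ∀ p ∈ s, VanishesAt L p

/-- No three distinct points of `s` are collinear. -/
def NoThreeCollinear (s : Set ProjPlane) : Prop :=
  ∀ p q r, p ∈ s → q ∈ s → r ∈ s → p ≠ q → p ≠ r → q ≠ r → ¬ Collin {p, q, r}

/-- `L` is a (the) line through the points `p` and `q`. -/
def IsLineThrough (L : Poly3) (p q : ProjPlane) : Prop :=
  L ≠ 0 ∧ L.IsHomogeneous 1 ∧ VanishesAt L p ∧ VanishesAt L q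

/-- `L` is the generalized Pascal line of the cubics `D₁` and `D₂` with respect to six
points `A, …, F`: the cubics have no common nonconstant factor, their common zero set
consists of exactly nine distinct points (the six given ones plus three further points),
and `L` is the line through the three further intersection points. -/
def IsGenPascalLine (A B C D E F : ProjPlane) (D₁ D₂ L : Poly3) : Prop :=
  IsRelPrime D₁ D₂ ∧ L ≠ 0 ∧ L.IsHomogeneous 1 ∧
    ∃ P Q R : ProjPlane,
      ([A, B, C, D, E, F, P, Q, R] : List ProjPlane).Pairwise (· ≠ ·) ∧
      zeroSet D₁ ∩ zeroSet D₂ = {A, B, C, D, E, F, P, Q, R} ∧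
      VanishesAt L P ∧ VanishesAt L Q ∧ VanishesAt L R

/-- Multiplying a relation `L * K, M * K ∈ (F, G)` across gives a cofactor `t`; if `t` lies in
`(L, M)` then `K` itself lies in `(F, G)`. -/
theorem exists_cofactor {R : Type*} [CommRing R] [IsDomain R] [DecompositionMonoid R]
    {F G L M K a b c d : R} (hG : G ≠ 0) (hFG : IsRelPrime F G)
    (hL : L ≠ 0) (hLM : IsRelPrime L M)
    (hLK : a * F + b * G = L * K) (hMK : c * F + d * G = M * K) :
    ∃ t, M * a - L * c = G * t ∧
      ∀ u v, t = M * u - L * v → K ∈ Ideal.span {F, G} := by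
  have key : (M * a - L * c) * F = (L * d - M * b) * G := by
    linear_combination M * hLK - L * hMK
  obtain ⟨t, ht⟩ : G ∣ M * a - L * c :=
    hFG.symm.dvd_of_dvd_mul_right ⟨L * d - M * b, by rw [key, mul_comm]⟩
  have ht' : L * d - M * b = F * t :=
    mul_right_cancel₀ hG (by rw [← key, ht]; ring)
  refine ⟨t, ht, fun u v huv => ?_⟩
  obtain ⟨a', ha'⟩ : L ∣ a - G * u :=
    hLM.dvd_of_dvd_mul_left ⟨c - G * v, by linear_combination ht + G * huv⟩
  obtain ⟨b', hb'⟩ : L ∣ b + F * u :=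
    hLM.dvd_of_dvd_mul_left ⟨d + F * v, by linear_combination -ht' - F * huv⟩
  refine Ideal.mem_span_pair.2 ⟨a', b', mul_left_cancel₀ hL ?_⟩
  linear_combination hLK - F * ha' - G * hb'

theorem MvPolynomial.IsHomogeneous.irreducible_of_one {σ k : Type*} [Field k]
    {L : MvPolynomial σ k} (hL : L.IsHomogeneous 1) (h0 : L ≠ 0) : Irreducible L := by
  have isUnit_of_totalDegree : ∀ a : MvPolynomial σ k, a ≠ 0 → a.totalDegree = 0 → IsUnit a := by
    intro a ha h
    rw [totalDegree_eq_zero_iff_eq_C] at h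
    rw [h, ne_eq, C_eq_zero] at ha
    rw [h]
    exact (isUnit_iff_ne_zero.2 ha).map C
  refine ⟨fun hu => ?_, fun a b hab => ?_⟩
  · obtain ⟨M, hM⟩ := hu.exists_right_inv
    have hM0 : M ≠ 0 := by rintro rfl; simp at hM
    have := totalDegree_mul_of_isDomain h0 hM0
    rw [hM, totalDegree_one, hL.totalDegree h0] at this
    omega
  · have ha : a ≠ 0 := by rintro rfl; simp [hab] at h0
    have hb : b ≠ 0 := by rintro rfl; simp [hab] at h0
    have := totalDegree_mul_of_isDomain ha hb
    rw [← hab, hL.totalDegree h0] at this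
    rcases Nat.eq_zero_or_pos a.totalDegree with h | h
    · exact .inl (isUnit_of_totalDegree a ha h)
    · exact .inr (isUnit_of_totalDegree b hb (by omega))

/-- Two linear forms are relatively prime if the second one does not vanish at some zero of
the first one. -/
theorem isRelPrime_of_eval {σ k : Type*} [Field k] {L M : MvPolynomial σ k}
    (hL : L.IsHomogeneous 1) (h0 : L ≠ 0) (v : σ → k) (hLv : eval v L = 0)
    (hMv : eval v M ≠ 0) : IsRelPrime L M := by
  refine (hL.irreducible_of_one h0).isRelPrime_iff_not_dvd.2 ?_
  rintro ⟨c, rfl⟩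
  simp [hLv] at hMv

theorem isRelPrime_X {i j : Fin 3} (h : i ≠ j) : IsRelPrime (X i : Poly3) (X j) :=
  isRelPrime_of_eval (isHomogeneous_X _ _) (X_ne_zero _) (Pi.single j 1) (by simp [h]) (by simp)

theorem mem_span_of_X_two_mul {t a b : Poly3} (h : X 2 * t = X 1 * a - X 0 * b) :
    ∃ u v, t = X 1 * u - X 0 * v := by
  have mem : X 2 * t ∈ Ideal.span (X '' ({0, 1} : Set (Fin 3)) : Set Poly3) := by
    rw [h, Set.image_pair]
    exact Ideal.mem_span_pair.2 ⟨-b, a, by ring⟩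
  have : t ∈ Ideal.span (X '' ({0, 1} : Set (Fin 3)) : Set Poly3) := by
    rw [mem_ideal_span_X_image] at mem ⊢
    intro m hm
    obtain ⟨i, hi, hmi⟩ := mem (Finsupp.single 2 1 + m) (by
      rw [mem_support_iff] at hm ⊢
      rwa [coeff_X_mul])
    refine ⟨i, hi, ?_⟩
    rcases hi with rfl | rfl <;> simpa [Finsupp.single_apply] using hmi
  rw [Set.image_pair, Ideal.mem_span_pair] at this
  obtain ⟨c, d, rfl⟩ := this
  exact ⟨d, -c, by ring⟩

/-- The ideal generated by two relatively prime polynomials in three variables is saturated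
with respect to the irrelevant ideal. -/
theorem mem_span_of_forall_X_mul_mem {F G K : Poly3} (hG : G ≠ 0) (hFG : IsRelPrime F G)
    (h : ∀ i, X i * K ∈ Ideal.span {F, G}) : K ∈ Ideal.span {F, G} := by
  choose a b hab using fun i => Ideal.mem_span_pair.1 (h i)
  have rel {i j : Fin 3} (hij : i ≠ j) :=
    exists_cofactor hG hFG (X_ne_zero i) (isRelPrime_X hij) (hab i) (hab j)
  obtain ⟨t, ht, hK⟩ := rel (i := 0) (j := 1) (by decide)
  obtain ⟨t', ht', -⟩ := rel (i := 0) (j := 2) (by decide)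
  obtain ⟨t'', ht'', -⟩ := rel (i := 1) (j := 2) (by decide)
  obtain ⟨u, v, huv⟩ := mem_span_of_X_two_mul (t := t) (a := t') (b := t'')
    (mul_left_cancel₀ hG (by linear_combination X 1 * ht' - X 0 * ht'' - X 2 * ht))
  exact hK u v huv

section Homogeneous

variable {σ k : Type*} [CommRing k]

theorem coe_decompose_eq_homogeneousComponent (φ : MvPolynomial σ k) (n : ℕ) :
    letI := gradedAlgebra (σ := σ) (R := k)
    (DirectSum.decompose (homogeneousSubmodule σ k) φ n : MvPolynomial σ k) =
      homogeneousComponent n φ :=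
  decomposition.decompose'_apply φ n

theorem homogeneousComponent_mul_of_isHomogeneous {F : MvPolynomial σ k} {p : ℕ}
    (hF : F.IsHomogeneous p) (a : MvPolynomial σ k) (m : ℕ) :
    homogeneousComponent (m + p) (a * F) = homogeneousComponent m a * F := by
  let := gradedAlgebra (σ := σ) (R := k)
  rw [← coe_decompose_eq_homogeneousComponent, ← coe_decompose_eq_homogeneousComponent]
  exact DirectSum.coe_decompose_mul_add_of_right_mem (homogeneousSubmodule σ k) (a := a) hF

theorem homogeneousComponent_mul_of_lt {F : MvPolynomial σ k} {p : ℕ}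
    (hF : F.IsHomogeneous p) (a : MvPolynomial σ k) {n : ℕ} (h : n < p) :
    homogeneousComponent n (a * F) = 0 := by
  let := gradedAlgebra (σ := σ) (R := k)
  rw [← coe_decompose_eq_homogeneousComponent]
  exact DirectSum.coe_decompose_mul_of_right_mem_of_not_le (homogeneousSubmodule σ k) (a := a) hF
    (not_le.2 h)

theorem exists_mul_eq_homogeneousComponent {F : MvPolynomial σ k} {p : ℕ}
    (hF : F.IsHomogeneous p) (a : MvPolynomial σ k) (n : ℕ) :
    ∃ a', a' * F = homogeneousComponent n (a * F) ∧ (a' ≠ 0 → a'.totalDegree + p ≤ n) := by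
  rcases lt_or_ge n p with h | h
  · exact ⟨0, by rw [homogeneousComponent_mul_of_lt hF a h, zero_mul], by simp⟩
  · obtain ⟨m, rfl⟩ := Nat.exists_eq_add_of_le' h
    refine ⟨homogeneousComponent m a, (homogeneousComponent_mul_of_isHomogeneous hF a m).symm,
      fun _ => ?_⟩
    have := (homogeneousComponent_isHomogeneous m a).totalDegree_le
    omega

/-- A form of degree `n` in the ideal generated by two forms is a combination of them with
coefficients of the expected degrees. -/
theorem exists_totalDegree_le_of_mem_span_pair {F G K : MvPolynomial σ k} {p q n : ℕ}
    (hF : F.IsHomogeneous p) (hG : G.IsHomogeneous q) (hK : K.IsHomogeneous n)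
    (h : K ∈ Ideal.span {F, G}) :
    ∃ a b, a * F + b * G = K ∧ (a ≠ 0 → a.totalDegree + p ≤ n) := by
  obtain ⟨a, b, hab⟩ := Ideal.mem_span_pair.1 h
  obtain ⟨a', ha', hdeg⟩ := exists_mul_eq_homogeneousComponent hF a n
  obtain ⟨b', hb', -⟩ := exists_mul_eq_homogeneousComponent hG b n
  refine ⟨a', b', ?_, hdeg⟩
  rw [ha', hb', ← map_add, hab, homogeneousComponent_eq_self hK]

end Homogeneous

theorem finrank_homogeneousSubmodule (n : ℕ) :
    Module.finrank ℂ (homogeneousSubmodule (Fin 3) ℂ n) = (n + 2).choose 2 := by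
  rw [homogeneousSubmodule_eq_finsupp_supported]
  have e : {d : Fin 3 →₀ ℕ | d.degree = n} =
      ((Finset.univ : Finset (Fin 3)).finsuppAntidiag n : Set (Fin 3 →₀ ℕ)) := by
    ext d
    simp [Finset.mem_finsuppAntidiag, Finsupp.degree_eq_sum]
  rw [e]
  refine (LinearEquiv.finrank_eq (AddMonoidAlgebra.supportedEquivFinsupp (R := ℂ) (S := ℂ) _)).trans ?_
  rw [Module.finrank_finsupp_self, ← Nat.card_eq_fintype_card,
    Nat.card_coe_set_eq, Set.ncard_coe_finset, Finset.card_finsuppAntidiag_nat_eq_choose]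
  simp only [Finset.card_univ, Fintype.card_fin]
  rw [show 3 + n - 1 = n + 2 by omega]
  exact Nat.choose_symm_add

instance (n : ℕ) : Module.Finite ℂ (homogeneousSubmodule (Fin 3) ℂ n) :=
  Module.Finite.of_fg (homogeneousSubmodule_fg _ _ n)

theorem choose_two_add_add (e p q : ℕ) :
    (e + q + 2).choose 2 + (e + p + 2).choose 2 + p * q =
      (e + 2).choose 2 + (e + p + q + 2).choose 2 := by
  have h (n : ℕ) : ((n + 2).choose 2 : ℚ) = (n + 2) * (n + 1) / 2 := by
    rw [Nat.cast_choose_two]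
    push_cast
    ring
  have : (((e + q + 2).choose 2 + (e + p + 2).choose 2 + p * q : ℕ) : ℚ) =
      ((e + 2).choose 2 + (e + p + q + 2).choose 2 : ℕ) := by
    push_cast [h]
    ring
  exact_mod_cast this

/-- The map `(a, b) ↦ a * F + b * G` on forms. -/
def combination {p q : ℕ} {F G : Poly3} (hF : F.IsHomogeneous p) (hG : G.IsHomogeneous q)
    (e : ℕ) :
    homogeneousSubmodule (Fin 3) ℂ (e + q) × homogeneousSubmodule (Fin 3) ℂ (e + p) →ₗ[ℂ]
      homogeneousSubmodule (Fin 3) ℂ (e + p + q) where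
  toFun x := ⟨x.1 * F + x.2 * G, by
    refine IsHomogeneous.add ?_ ?_
    · have := IsHomogeneous.mul x.1.2 hF
      rwa [add_right_comm] at this
    · exact IsHomogeneous.mul x.2.2 hG⟩
  map_add' x y := Subtype.ext (by simp; ring)
  map_smul' c x := Subtype.ext (by simp)

/-- The Koszul map `t ↦ (t * G, -(t * F))` on forms. -/
def koszul {p q : ℕ} {F G : Poly3} (hF : F.IsHomogeneous p) (hG : G.IsHomogeneous q) (e : ℕ) :
    homogeneousSubmodule (Fin 3) ℂ e →ₗ[ℂ]
      homogeneousSubmodule (Fin 3) ℂ (e + q) × homogeneousSubmodule (Fin 3) ℂ (e + p) where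
  toFun t := (⟨t * G, IsHomogeneous.mul t.2 hG⟩, ⟨-(t * F), (IsHomogeneous.mul t.2 hF).neg⟩)
  map_add' x y := by ext1 <;> exact Subtype.ext (by simp; ring)
  map_smul' c x := by ext1 <;> exact Subtype.ext (by simp)

theorem ker_combination_le {p q : ℕ} {F G : Poly3} (hF : F.IsHomogeneous p)
    (hG : G.IsHomogeneous q) (hG0 : G ≠ 0) (hFG : IsRelPrime F G) (e : ℕ) :
    LinearMap.ker (combination hF hG e) ≤ LinearMap.range (koszul hF hG e) := by
  rintro ⟨⟨a, ha⟩, ⟨b, hb⟩⟩ h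
  have h : a * F + b * G = 0 := congrArg Subtype.val h
  obtain ⟨t, rfl⟩ : G ∣ a :=
    hFG.symm.dvd_of_dvd_mul_right ⟨-b, by linear_combination h⟩
  have hb' : b = -(t * F) := mul_right_cancel₀ hG0 (by linear_combination h)
  have ht : homogeneousComponent e t * G = G * t := by
    rw [← homogeneousComponent_mul_of_isHomogeneous hG, mul_comm t]
    exact homogeneousComponent_eq_self ha
  have ht' : homogeneousComponent e t = t := mul_right_cancel₀ hG0 (by rw [ht, mul_comm])
  refine ⟨⟨t, ?_⟩, ?_⟩
  · rw [← ht']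
    exact homogeneousComponent_mem _ _
  · ext1 <;> apply Subtype.ext
    · exact mul_comm _ _
    · exact hb'.symm

theorem le_finrank_range_combination {p q : ℕ} {F G : Poly3} (hF : F.IsHomogeneous p)
    (hG : G.IsHomogeneous q) (hG0 : G ≠ 0) (hFG : IsRelPrime F G) (e : ℕ) :
    (e + p + q + 2).choose 2 ≤
      Module.finrank ℂ (LinearMap.range (combination hF hG e)) + p * q := by
  have h₁ := (combination hF hG e).finrank_range_add_finrank_ker
  have h₂ := Submodule.finrank_mono (ker_combination_le hF hG hG0 hFG e)
  have h₃ := (koszul hF hG e).finrank_range_le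
  rw [Module.finrank_prod, finrank_homogeneousSubmodule, finrank_homogeneousSubmodule] at h₁
  rw [finrank_homogeneousSubmodule] at h₃
  have := choose_two_add_add e p q
  omega

/-- Evaluation of forms of degree `n` at the points of `S`. -/
def evalPoints (S : Finset ProjPlane) (n : ℕ) :
    homogeneousSubmodule (Fin 3) ℂ n →ₗ[ℂ] (S → ℂ) where
  toFun K y := eval y.1.rep K.1
  map_add' K L := by ext; simp
  map_smul' c K := by ext; simp

theorem mem_ker_evalPoints {S : Finset ProjPlane} {n : ℕ}
    {K : homogeneousSubmodule (Fin 3) ℂ n} :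
    K ∈ LinearMap.ker (evalPoints S n) ↔ ∀ y ∈ S, VanishesAt K.1 y := by
  rw [LinearMap.mem_ker, funext_iff, Subtype.forall]
  rfl

/-- The linear form `v i * X j - v j * X i`, which vanishes at `v`. -/
def lineForm (v : Fin 3 → ℂ) (i j : Fin 3) : Poly3 := C (v i) * X j - C (v j) * X i

theorem lineForm_isHomogeneous (v : Fin 3 → ℂ) (i j : Fin 3) :
    (lineForm v i j).IsHomogeneous 1 :=
  (isHomogeneous_C_mul_X _ _).sub (isHomogeneous_C_mul_X _ _)

theorem eval_lineForm (v w : Fin 3 → ℂ) (i j : Fin 3) :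
    eval w (lineForm v i j) = v i * w j - v j * w i := by
  simp [lineForm]

theorem exists_linear_ne_zero (y : ProjPlane) :
    ∃ L : Poly3, L.IsHomogeneous 1 ∧ eval y.rep L ≠ 0 := by
  obtain ⟨i, hi⟩ := Function.ne_iff.1 y.rep_nonzero
  exact ⟨X i, isHomogeneous_X _ _, by simpa using hi⟩

theorem exists_linear_separating {s y : ProjPlane} (h : s ≠ y) :
    ∃ L : Poly3, L.IsHomogeneous 1 ∧ eval s.rep L = 0 ∧ eval y.rep L ≠ 0 := by
  obtain ⟨i, hi⟩ := Function.ne_iff.1 s.rep_nonzero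
  by_contra! H
  have hy (j : Fin 3) : s.rep i * y.rep j = s.rep j * y.rep i := by
    have := H _ (lineForm_isHomogeneous s.rep i j) (by rw [eval_lineForm]; ring)
    rw [eval_lineForm] at this
    linear_combination this
  apply h
  rw [← s.mk_rep, ← y.mk_rep, eq_comm, Projectivization.mk_eq_mk_iff']
  refine ⟨y.rep i / s.rep i, funext fun j => ?_⟩
  rw [Pi.smul_apply, smul_eq_mul, div_mul_eq_mul_div, div_eq_iff hi]
  linear_combination -hy j

theorem exists_interpolating (S : Finset ProjPlane) (y : ProjPlane) {n : ℕ}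
    (hn : S.card ≤ n) :
    ∃ P : Poly3, P.IsHomogeneous n ∧ eval y.rep P ≠ 0 ∧
      ∀ s ∈ S, s ≠ y → eval s.rep P = 0 := by
  classical
  induction S using Finset.induction_on generalizing n with
  | empty =>
    obtain ⟨L, hL, hLy⟩ := exists_linear_ne_zero y
    exact ⟨L ^ n, by simpa using hL.pow n, by simp [hLy], by simp⟩
  | insert s S hs ih =>
    rw [Finset.card_insert_of_notMem hs] at hn
    obtain ⟨m, rfl⟩ := Nat.exists_eq_add_of_le' (show 1 ≤ n by omega)
    obtain ⟨P, hP, hPy, hPS⟩ := ih (n := m) (by omega)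
    obtain ⟨L, hL, hLy, hLs⟩ : ∃ L : Poly3, L.IsHomogeneous 1 ∧ eval y.rep L ≠ 0 ∧
        (s ≠ y → eval s.rep L = 0) := by
      by_cases h : s = y
      · obtain ⟨L, hL, hLy⟩ := exists_linear_ne_zero y
        exact ⟨L, hL, hLy, fun h' => absurd h h'⟩
      · obtain ⟨L, hL, hLs, hLy⟩ := exists_linear_separating h
        exact ⟨L, hL, hLy, fun _ => hLs⟩
    refine ⟨P * L, hP.mul hL, by simp [hPy, hLy], fun s' hs' hne => ?_⟩
    rw [map_mul]
    rcases Finset.mem_insert.1 hs' with rfl | hs'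
    · rw [hLs hne, mul_zero]
    · rw [hPS s' hs' hne, zero_mul]

theorem evalPoints_surjective (S : Finset ProjPlane) {n : ℕ} (hn : S.card ≤ n) :
    Function.Surjective (evalPoints S n) := by
  classical
  intro c
  choose P hP hPy hPS using fun y => exists_interpolating S y hn
  refine ⟨∑ y : S, (c y / eval y.1.rep (P y)) • ⟨P y, hP y⟩, ?_⟩
  rw [map_sum]
  funext s
  rw [Finset.sum_apply, Finset.sum_eq_single s]
  · simp only [map_smul, Pi.smul_apply, smul_eq_mul]
    exact div_mul_cancel₀ _ (hPy s)
  · intro y _ hy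
    simp only [map_smul, Pi.smul_apply, smul_eq_mul]
    exact mul_eq_zero_of_right _ (hPS y s s.2 fun h => hy (Subtype.ext h.symm))
  · simp

/-- In large degrees, the forms vanishing at all `p * q` common zeros of `F` and `G` lie in the
ideal generated by `F` and `G`. -/
theorem mem_span_of_large_degree {p q : ℕ} {F G : Poly3} (hF : F.IsHomogeneous p)
    (hG : G.IsHomogeneous q) (hG0 : G ≠ 0) (hFG : IsRelPrime F G) {S : Finset ProjPlane}
    (hS : (S : Set ProjPlane) = zeroSet F ∩ zeroSet G) (hcard : S.card = p * q) {n : ℕ}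
    (hn : p * q + p + q ≤ n) {K : Poly3} (hK : K.IsHomogeneous n)
    (hKS : ∀ y ∈ S, VanishesAt K y) : K ∈ Ideal.span {F, G} := by
  obtain ⟨e, rfl⟩ : ∃ e, n = e + p + q := ⟨n - p - q, by omega⟩
  have hle : LinearMap.range (combination hF hG e) ≤ LinearMap.ker (evalPoints S (e + p + q)) := by
    rintro _ ⟨x, rfl⟩
    refine mem_ker_evalPoints.2 fun y hy => ?_
    obtain ⟨hy₁, hy₂⟩ : y ∈ zeroSet F ∩ zeroSet G := hS ▸ hy
    change eval y.rep (x.1.1 * F + x.2.1 * G) = 0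
    rw [map_add, map_mul, map_mul, show eval y.rep F = 0 from hy₁,
      show eval y.rep G = 0 from hy₂]
    simp
  have hrank := (evalPoints S (e + p + q)).finrank_range_add_finrank_ker
  rw [LinearMap.range_eq_top.2 (evalPoints_surjective S (by omega)), finrank_top,
    Module.finrank_fintype_fun_eq_card, Fintype.card_coe, hcard,
    finrank_homogeneousSubmodule] at hrank
  have hle' := le_finrank_range_combination hF hG hG0 hFG e
  have heq := Submodule.eq_of_le_of_finrank_le hle (by omega)
  have hmem : (⟨K, hK⟩ : homogeneousSubmodule (Fin 3) ℂ (e + p + q)) ∈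
      LinearMap.range (combination hF hG e) := by
    rw [heq]
    exact mem_ker_evalPoints.2 hKS
  obtain ⟨x, hx⟩ := hmem
  exact Ideal.mem_span_pair.2 ⟨x.1.1, x.2.1, congrArg Subtype.val hx⟩

/-- **Max Noether's theorem** for two curves meeting transversally: every form vanishing at all
`p * q` common zeros of `F` and `G` lies in the ideal generated by `F` and `G`. -/
theorem mem_span_of_forall_vanishesAt {p q : ℕ} {F G : Poly3} (hF : F.IsHomogeneous p)
    (hG : G.IsHomogeneous q) (hG0 : G ≠ 0) (hFG : IsRelPrime F G) {S : Finset ProjPlane}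
    (hS : (S : Set ProjPlane) = zeroSet F ∩ zeroSet G) (hcard : S.card = p * q) {n : ℕ}
    {K : Poly3} (hK : K.IsHomogeneous n) (hKS : ∀ y ∈ S, VanishesAt K y) :
    K ∈ Ideal.span {F, G} := by
  rcases le_total (p * q + p + q) n with h | h
  · exact mem_span_of_large_degree hF hG hG0 hFG hS hcard h hK hKS
  induction h using Nat.decreasingInduction generalizing K with
  | self => exact mem_span_of_large_degree hF hG hG0 hFG hS hcard le_rfl hK hKS
  | of_succ m _ ih =>
    refine mem_span_of_forall_X_mul_mem hG0 hFG fun i => ih ?_ fun y hy => ?_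
    · rw [add_comm]
      exact (isHomogeneous_X _ i).mul hK
    · change eval _ _ = 0
      rw [map_mul, show eval y.rep K = 0 from hKS y hy, mul_zero]

/-- Every point of the plane is a common zero of two relatively prime linear forms. -/
theorem exists_isRelPrime_linear (x : ProjPlane) :
    ∃ L M : Poly3, L.IsHomogeneous 1 ∧ M.IsHomogeneous 1 ∧ L ≠ 0 ∧ IsRelPrime L M ∧
      VanishesAt L x ∧ VanishesAt M x := by
  obtain ⟨k, hk⟩ := Function.ne_iff.1 x.rep_nonzero
  obtain ⟨i, j, hik, hjk, hij⟩ : ∃ i j : Fin 3, i ≠ k ∧ j ≠ k ∧ i ≠ j := by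
    clear hk
    decide +revert
  have hvan (l : Fin 3) : VanishesAt (lineForm x.rep k l) x :=
    (eval_lineForm _ _ _ _).trans (by ring)
  have hne {l : Fin 3} (hl : l ≠ k) : eval (Pi.single l 1) (lineForm x.rep k l) ≠ 0 := by
    rw [eval_lineForm]
    simpa [hl.symm] using hk
  have h0 : lineForm x.rep k i ≠ 0 := fun h => hne hik (by rw [h, map_zero])
  refine ⟨lineForm x.rep k i, lineForm x.rep k j, lineForm_isHomogeneous _ _ _,
    lineForm_isHomogeneous _ _ _, h0, ?_, hvan i, hvan j⟩
  refine isRelPrime_of_eval (lineForm_isHomogeneous _ _ _) h0 (Pi.single j 1) ?_ (hne hjk)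
  rw [eval_lineForm]
  simp [hij, hjk.symm]

/-- **The Cayley–Bacharach theorem.** Let `F` and `G` be curves of degrees `p` and `q`
with no common nonconstant factor meeting in exactly `p·q` distinct points. Any curve of
degree `r ≤ p + q - 3` through `p·q - 1` of these points also passes through the last one. -/
theorem cayley_bacharach (p q : ℕ) (F G : Poly3) (hF : F ≠ 0) (hG : G ≠ 0)
    (hFh : F.IsHomogeneous p) (hGh : G.IsHomogeneous q) (hrp : IsRelPrime F G)
    (S : Finset ProjPlane) (hS : (S : Set ProjPlane) = zeroSet F ∩ zeroSet G)
    (hScard : S.card = p * q)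
    (r : ℕ) (hr : r + 3 ≤ p + q)
    (H : Poly3) (hH : H ≠ 0) (hHh : H.IsHomogeneous r)
    (x : ProjPlane) (hx : x ∈ S)
    (hHv : ∀ y ∈ S, y ≠ x → VanishesAt H y) :
    VanishesAt H x := by
  obtain ⟨L, M, hL, hM, hL0, hLM, hLx, hMx⟩ := exists_isRelPrime_linear x
  have mem {N : Poly3} (hN : N.IsHomogeneous 1) (hNx : VanishesAt N x) :
      ∃ a b, a * F + b * G = N * H ∧ (a ≠ 0 → a.totalDegree + p ≤ 1 + r) := by
    refine exists_totalDegree_le_of_mem_span_pair hFh hGh (hN.mul hHh)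
      (mem_span_of_forall_vanishesAt hFh hGh hG hrp hS hScard (hN.mul hHh) fun y hy => ?_)
    change eval _ _ = 0
    rw [map_mul]
    by_cases hyx : y = x
    · rw [hyx, show eval x.rep N = 0 from hNx, zero_mul]
    · rw [show eval y.rep H = 0 from hHv y hy hyx, mul_zero]
  obtain ⟨a, b, hab, ha⟩ := mem hL hLx
  obtain ⟨c, d, hcd, hc⟩ := mem hM hMx
  obtain ⟨t, ht, hH'⟩ := exists_cofactor hG hrp hL0 hLM hab hcd
  have ht0 : t = 0 := by
    by_contra ht0
    have hdeg := totalDegree_mul_of_isDomain hG ht0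
    rw [← ht, hGh.totalDegree hG] at hdeg
    have hprod {N e : Poly3} (hN : N.IsHomogeneous 1)
        (he : e ≠ 0 → e.totalDegree + p ≤ 1 + r) : (N * e).totalDegree < q := by
      rcases eq_or_ne e 0 with rfl | h
      · have : q ≠ 0 := by
          rintro rfl
          simp [Finset.card_eq_zero.1 (hScard.trans (mul_zero p))] at hx
        simpa using Nat.pos_of_ne_zero this
      · have := totalDegree_mul N e
        have := hN.totalDegree_le
        have := he h
        omega
    have := totalDegree_sub (M * a) (L * c)
    have := max_lt (hprod hM ha) (hprod hL hc)
    omega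
  obtain ⟨a', b', hab'⟩ := Ideal.mem_span_pair.1 (hH' 0 0 (by simp [ht0]))
  obtain ⟨hxF, hxG⟩ : x ∈ zeroSet F ∩ zeroSet G := hS ▸ hx
  change eval x.rep H = 0
  rw [← hab', map_add, map_mul, map_mul, show eval x.rep F = 0 from hxF,
    show eval x.rep G = 0 from hxG]
  simp
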